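/- Let n ≥ 4 be an integer and r₁ ≥ 2, r₂ ≥ 1 integers with r₁ + r₂ = n − 1, and fix real constants C₁ ≠ 0, C₂, C₃ and μ₁. Suppose a smooth function f on an open interval I ⊆ ℝ satisfies equations (E1) and (E2) at every point of I and f'(s) ≠ 0 for all s ∈ I. Then there exist real numbers a₈, a₄, a₀ (depending only on n, r₁, r₂, C₁ and μ₁) such that, with a₁₂ = −(n − 2)²·(4n − 3r₁ − 5)²/(81·(n − 1)⁶·(r₁ − 1)⁴) (which is nonzero), the polynomial identity a₁₂·f'(s)¹² + a₈·f'(s)⁸ + a₄·f'(s)⁴ + a₀ = 0 holds for all s ∈ I. -/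

import Mathlib

theorem aux_alg_C (k r M K u v w L L1 : ℝ) (hM : M = k + r + 1) (hu : u ≠ 0)
    (hE1 : M * w * L = M * u * v - u ^ 3)
    (hA : M * (k * v ^ 2 - K) * L = M * k * u ^ 2 * v - (k + r) * u ^ 4)
    (hL : M * L1 = u * (L + M))
    (hdA : M * (2 * k * v * w * L + (k * v ^ 2 - K) * L1)
      = M * k * (2 * u * v ^ 2 + u ^ 2 * w) - 4 * (k + r) * u ^ 3 * v) :
    M * r * u ^ 2 = (M * (3 * k + 4 * r) * v - (k + r) * u ^ 2) * L := by
  have hB : u * (-(M * k * u ^ 2 * v) - (k + r) * u ^ 4 + M ^ 2 * (k * v ^ 2 - K)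
      - M ^ 2 * k * u * w + 4 * (k + r) * M * u ^ 2 * v) = 0 := by
    linear_combination M * hdA - 2 * k * v * M * hE1 - u * hA - M * (k * v ^ 2 - K) * hL
  have hB' := (mul_eq_zero.mp hB).resolve_left hu
  have h : u ^ 2 * (M * r * u ^ 2 - (M * (3 * k + 4 * r) * v - (k + r) * u ^ 2) * L) = 0 := by
    subst hM
    linear_combination (-L) * hB' + (k + r + 1) * hA - (k + r + 1) * k * u * hE1
  linarith [(mul_eq_zero.mp h).resolve_left (pow_ne_zero 2 hu)]

theorem aux_alg_Q (k r M u v w L L1 : ℝ) (hM : M = k + r + 1) (hM0 : M ≠ 0)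
    (hP : k + r ≠ 0) (hu : u ≠ 0)
    (hE1 : M * w * L = M * u * v - u ^ 3)
    (hC : M * r * u ^ 2 = (M * (3 * k + 4 * r) * v - (k + r) * u ^ 2) * L)
    (hL : M * L1 = u * (L + M))
    (hdC : M * r * (2 * u * v) = (M * (3 * k + 4 * r) * w - (k + r) * (2 * u * v)) * L
      + (M * (3 * k + 4 * r) * v - (k + r) * u ^ 2) * L1) :
    v * L = 3 * M * v - 2 * u ^ 2 ∧
    3 * (3 * k + 4 * r) * M ^ 2 * v ^ 2 - 3 * (3 * k + 4 * r) * M * v * u ^ 2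
      + 2 * (k + r) * u ^ 4 = 0 := by
  have hF : (u * (k + r) * M) * (v * L - (3 * M * v - 2 * u ^ 2)) = 0 := by
    have h : (2 : ℝ) * ((u * (k + r) * M) * (v * L - (3 * M * v - 2 * u ^ 2))) = 0 := by
      subst hM
      linear_combination (k + r + 1) * hdC + (k + r + 1) * (3 * k + 4 * r) * hE1
        + ((k + r + 1) * (3 * k + 4 * r) * v - (k + r) * u ^ 2) * hL - u * hC
    linarith
  have hF' := (mul_eq_zero.mp hF).resolve_left (by positivity)
  refine ⟨by linarith, ?_⟩
  have : 3 * (3 * k + 4 * r) * M ^ 2 * v ^ 2 - 3 * (3 * k + 4 * r) * M * v * u ^ 2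
      + 2 * (k + r) * u ^ 4 = 0 := by
    linear_combination (-(M * (3 * k + 4 * r) * v - (k + r) * u ^ 2)) * hF' - v * hC
  exact this

theorem aux_alg_false (k r M u v w L : ℝ) (hM0 : M ≠ 0)
    (hk : 0 < k) (hr : 0 < r) (hu : u ≠ 0)
    (hE1 : M * w * L = M * u * v - u ^ 3)
    (hF : v * L = 3 * M * v - 2 * u ^ 2)
    (hQ : 3 * (3 * k + 4 * r) * M ^ 2 * v ^ 2 - 3 * (3 * k + 4 * r) * M * v * u ^ 2
      + 2 * (k + r) * u ^ 4 = 0)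
    (hdQ : 3 * (3 * k + 4 * r) * M ^ 2 * (2 * v * w)
      - 3 * (3 * k + 4 * r) * M * (w * u ^ 2 + v * (2 * u * v))
      + 2 * (k + r) * (4 * u ^ 3 * v) = 0) : False := by
  obtain ⟨t, rfl⟩ : ∃ t, v = t * u ^ 2 / M := ⟨M * v / u ^ 2, by field_simp⟩
  obtain ⟨z, rfl⟩ : ∃ z, w = z * u ^ 3 / M ^ 2 := ⟨M ^ 2 * w / u ^ 3, by field_simp⟩
  obtain ⟨l, rfl⟩ : ∃ l, L = l * M := ⟨L / M, by field_simp⟩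
  have e1 : z * l = t - 1 := by
    field_simp at hE1
    linarith
  have e2 : t * l = 3 * t - 2 := by
    field_simp at hF
    linarith
  have e3 : 3 * (3 * k + 4 * r) * t ^ 2 - 3 * (3 * k + 4 * r) * t + 2 * (k + r) = 0 := by
    have : u ^ 4 * (3 * (3 * k + 4 * r) * t ^ 2 - 3 * (3 * k + 4 * r) * t + 2 * (k + r)) = 0 := by
      rw [← hQ]; field_simp
    exact (mul_eq_zero.mp this).resolve_left (pow_ne_zero 4 hu)
  have e4 : 3 * (3 * k + 4 * r) * (2 * t * z) - 3 * (3 * k + 4 * r) * (z + 2 * t ^ 2)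
      + 8 * (k + r) * t = 0 := by
    have : u ^ 5 / M * (3 * (3 * k + 4 * r) * (2 * t * z) - 3 * (3 * k + 4 * r) * (z + 2 * t ^ 2)
      + 8 * (k + r) * t) = 0 := by
      rw [← hdQ]; field_simp; ring
    exact (mul_eq_zero.mp this).resolve_left (by positivity)
  -- the discriminant is nonzero, so `z = 2 t ^ 2`
  have e5 : (3 * (3 * k + 4 * r) * (2 * t - 1)) * (z - 2 * t ^ 2) = 0 := by
    linear_combination e4 - 4 * t * e3
  have ht : t * 2 - 1 ≠ 0 := by
    intro h
    have : t = 1 / 2 := by linarith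
    subst this
    nlinarith
  have e6 : z = 2 * t ^ 2 := by
    have h3 : 3 * (3 * k + 4 * r) * (2 * t - 1) ≠ 0 :=
      mul_ne_zero (by positivity) (by rwa [mul_comm 2 t])
    linarith [(mul_eq_zero.mp e5).resolve_left h3]
  subst e6
  have e7 : (t * 2 - 1) * (3 * t - 1) = 0 := by
    linear_combination e1 - 2 * t * e2
  have e8 := (mul_eq_zero.mp e7).resolve_left ht
  have : t = 1 / 3 := by linarith
  subst this
  nlinarith

theorem aux_false (k r M K c : ℝ) (hM : M = k + r + 1) (hk : 0 < k) (hr : 0 < r) (C₂ : ℝ)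
    (a b : ℝ) (hab : a < b) (f : ℝ → ℝ)
    (hf : ContDiffOn ℝ (⊤ : ℕ∞) f (Set.Ioo a b))
    (hf' : ∀ s ∈ Set.Ioo a b, deriv f s ≠ 0)
    (hE1 : ∀ s ∈ Set.Ioo a b,
      M * deriv (deriv (deriv f)) s * (c * Real.exp ((f s - C₂) / M) - M)
        = M * deriv f s * deriv (deriv f) s - (deriv f s) ^ 3)
    (hE2 : ∀ s ∈ Set.Ioo a b,
      ((k + r) * deriv f s * deriv (deriv (deriv f)) s
          - k * (deriv (deriv f) s) ^ 2 + K) * (c * Real.exp ((f s - C₂) / M) - M)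
        = r * (deriv f s) ^ 2 * deriv (deriv f) s) : False := by
  have hM0 : M ≠ 0 := by rw [hM]; positivity
  have ho : IsOpen (Set.Ioo a b) := isOpen_Ioo
  have c1 : ContDiffOn ℝ (⊤ : ℕ∞) (deriv f) (Set.Ioo a b) := hf.deriv_of_isOpen ho (by simp)
  have c2 : ContDiffOn ℝ (⊤ : ℕ∞) (deriv (deriv f)) (Set.Ioo a b) :=
    c1.deriv_of_isOpen ho (by simp)
  have key : ∀ g : ℝ → ℝ, ContDiffOn ℝ (⊤ : ℕ∞) g (Set.Ioo a b) →
      ∀ s ∈ Set.Ioo a b, HasDerivAt g (deriv g s) s := fun g hg s hs =>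
    ((hg.differentiableOn (by simp)).differentiableAt (ho.mem_nhds hs)).hasDerivAt
  have d0 := key f hf
  have d1 := key _ c1
  have d2 := key _ c2
  generalize deriv (deriv (deriv f)) = w at *
  generalize deriv (deriv f) = v at *
  generalize deriv f = u at *
  obtain ⟨L, hLdef⟩ : ∃ L : ℝ → ℝ, L = fun s => c * Real.exp ((f s - C₂) / M) - M := ⟨_, rfl⟩
  have dL : ∀ s ∈ Set.Ioo a b, HasDerivAt L (u s * (L s + M) / M) s := by
    intro s hs
    have := (((((d0 s hs).sub_const C₂).div_const M).exp).const_mul c).sub_const M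
    rw [hLdef]
    refine this.congr_deriv ?_
    simp only
    ring
  have E1 : ∀ s ∈ Set.Ioo a b, M * w s * L s = M * u s * v s - (u s) ^ 3 := by
    intro s hs; rw [hLdef]; exact hE1 s hs
  have E2 : ∀ s ∈ Set.Ioo a b,
      ((k + r) * u s * w s - k * (v s) ^ 2 + K) * L s = r * (u s) ^ 2 * v s := by
    intro s hs; rw [hLdef]; exact hE2 s hs
  have deq : ∀ g h : ℝ → ℝ, (∀ s ∈ Set.Ioo a b, g s = h s) → ∀ s ∈ Set.Ioo a b, ∀ g' h' : ℝ,
      HasDerivAt g g' s → HasDerivAt h h' s → g' = h' := by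
    intro g h hgh s hs g' h' hg hh
    have : g =ᶠ[nhds s] h := Filter.eventually_of_mem (ho.mem_nhds hs) hgh
    exact hg.unique (hh.congr_of_eventuallyEq this)
  have hL1 : ∀ s, M * (u s * (L s + M) / M) = u s * (L s + M) := fun s => by field_simp
  have hA : ∀ s ∈ Set.Ioo a b, M * (k * v s ^ 2 - K) * L s
      = M * k * u s ^ 2 * v s - (k + r) * u s ^ 4 := by
    intro s hs
    linear_combination (k + r) * u s * E1 s hs - M * E2 s hs
  have hC : ∀ s ∈ Set.Ioo a b, M * r * u s ^ 2
      = (M * (3 * k + 4 * r) * v s - (k + r) * u s ^ 2) * L s := by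
    intro s hs
    refine aux_alg_C k r M K (u s) (v s) (w s) (L s) _ hM (hf' s hs) (E1 s hs) (hA s hs)
      (hL1 s) ?_
    have := deq _ _ hA s hs _ _
      (((((d2 s hs).fun_pow 2).const_mul k).sub_const K |>.const_mul M).fun_mul (dL s hs))
      (((((d1 s hs).fun_pow 2).const_mul (M * k)).fun_mul (d2 s hs)).fun_sub
        (((d1 s hs).fun_pow 4).const_mul (k + r)))
    norm_num at this
    linear_combination this
  have hFQ : ∀ s ∈ Set.Ioo a b, v s * L s = 3 * M * v s - 2 * u s ^ 2 ∧
      3 * (3 * k + 4 * r) * M ^ 2 * v s ^ 2 - 3 * (3 * k + 4 * r) * M * v s * u s ^ 2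
      + 2 * (k + r) * u s ^ 4 = 0 := by
    intro s hs
    refine aux_alg_Q k r M (u s) (v s) (w s) (L s) _ hM hM0 (by positivity) (hf' s hs) (E1 s hs)
      (hC s hs) (hL1 s) ?_
    have := deq _ _ hC s hs _ _
      (((d1 s hs).fun_pow 2).const_mul (M * r))
      ((((d2 s hs).const_mul (M * (3 * k + 4 * r))).fun_sub
        (((d1 s hs).fun_pow 2).const_mul (k + r))).fun_mul (dL s hs))
    norm_num at this
    linear_combination this
  obtain ⟨s, hs⟩ : (Set.Ioo a b).Nonempty := Set.nonempty_Ioo.mpr hab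
  refine aux_alg_false k r M (u s) (v s) (w s) (L s) hM0 hk hr (hf' s hs) (E1 s hs)
    (hFQ s hs).1 (hFQ s hs).2 ?_
  have := deq _ (fun _ => 0) (fun s hs => (hFQ s hs).2) s hs _ _
    (((((d2 s hs).fun_pow 2).const_mul (3 * (3 * k + 4 * r) * M ^ 2)).fun_sub
      (((d2 s hs).const_mul (3 * (3 * k + 4 * r) * M)).fun_mul ((d1 s hs).fun_pow 2))).fun_add
      (((d1 s hs).fun_pow 4).const_mul (2 * (k + r))))
    (hasDerivAt_const s (0 : ℝ))
  norm_num at this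
  linear_combination this

/-- Under (E1), (E2), r₁ ≥ 2 and f' ≠ 0 on I, there is a nonconstant
degree-12 polynomial with leading coefficient
a₁₂ = −(n−2)²(4n−3r₁−5)²/(81(n−1)⁶(r₁−1)⁴) ≠ 0 annihilating f' on I. -/
theorem stmt_7 (n r₁ r₂ : ℕ) (hn : 4 ≤ n) (hr₁ : 2 ≤ r₁) (hr₂ : 1 ≤ r₂)
    (hsum : r₁ + r₂ = n - 1)
    (C₁ C₂ C₃ μ₁ : ℝ) (hC₁ : C₁ ≠ 0)
    (a b : ℝ) (hab : a < b) (f : ℝ → ℝ)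
    (hf : ContDiffOn ℝ (⊤ : ℕ∞) f (Set.Ioo a b))
    (hf' : ∀ s ∈ Set.Ioo a b, deriv f s ≠ 0)
    (hE1 : ∀ s ∈ Set.Ioo a b,
      ((n : ℝ) - 1) * deriv (deriv (deriv f)) s
          * (C₁ * C₃ * Real.exp ((f s - C₂) / ((n : ℝ) - 1)) - ((n : ℝ) - 1))
        = ((n : ℝ) - 1) * deriv f s * deriv (deriv f) s - (deriv f s) ^ 3)
    (hE2 : ∀ s ∈ Set.Ioo a b,
      (((n : ℝ) - 2) * deriv f s * deriv (deriv (deriv f)) s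
          - ((r₁ : ℝ) - 1) * (deriv (deriv f) s) ^ 2 + C₁ ^ 2 * μ₁)
          * (C₁ * C₃ * Real.exp ((f s - C₂) / ((n : ℝ) - 1)) - ((n : ℝ) - 1))
        = (r₂ : ℝ) * (deriv f s) ^ 2 * deriv (deriv f) s) :
    (-((n : ℝ) - 2) ^ 2 * (4 * (n : ℝ) - 3 * (r₁ : ℝ) - 5) ^ 2
        / (81 * ((n : ℝ) - 1) ^ 6 * ((r₁ : ℝ) - 1) ^ 4)) ≠ 0 ∧
    ∃ a₈ a₄ a₀ : ℝ, ∀ s ∈ Set.Ioo a b,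
      (-((n : ℝ) - 2) ^ 2 * (4 * (n : ℝ) - 3 * (r₁ : ℝ) - 5) ^ 2
          / (81 * ((n : ℝ) - 1) ^ 6 * ((r₁ : ℝ) - 1) ^ 4)) * (deriv f s) ^ 12
        + a₈ * (deriv f s) ^ 8 + a₄ * (deriv f s) ^ 4 + a₀ = 0 := by
  exfalso
  have hn' : (n : ℝ) = r₁ + r₂ + 1 := by
    have : n = r₁ + r₂ + 1 := by omega
    rw [this]; push_cast; ring
  have h1 : (2 : ℝ) ≤ r₁ := by exact_mod_cast hr₁
  have h2 : (1 : ℝ) ≤ r₂ := by exact_mod_cast hr₂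
  refine aux_false ((r₁ : ℝ) - 1) r₂ ((n : ℝ) - 1) (C₁ ^ 2 * μ₁) (C₁ * C₃) (by linarith)
    (by linarith) (by linarith) C₂ a b hab f hf hf' hE1 ?_
  intro s hs
  have h3 : (r₁ : ℝ) - 1 + r₂ = n - 2 := by linarith
  rw [h3]
  exact hE2 s hs
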